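/- arXiv:1509.08688 — 3 statements merged into one kernel-verified Lean document; each statement's English description precedes it below -/
import Mathlib

section
/- Let S be a Noetherian topological space with the property that no nonempty irreducible closed subset T of S is equal to a union of countably many closed subsets each properly contained in T. For each integer n ≥ 1 let g_n : S → ℝ be a function with g_n(s) ≥ 1 for all s ∈ S, and assume: for every nonempty irreducible closed subset T ⊆ S and every n ≥ 1 there exist a closed subset Z ⊆ S with Z ⊊ T and a real number c ≥ 1 such that g_n(t) = c for every t ∈ T \ Z and g_n(t) ≤ c for every t ∈ T. Assume moreover that for every s ∈ S the sequence n ↦ g_n(s)^(1/n) converges to a limit λ(s). Then for every a ∈ ℝ the sublevel set {s ∈ S : λ(s) ≤ a} is a union of countably many closed subsets of S. -/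
open Filter Topology

/-- A countable union of sets, each a countable union of closed sets, is itself a countable union
of closed sets. -/
theorem exists_isClosed_iUnion_nat_of_iUnion {S : Type*} [TopologicalSpace S] (A : ℕ → Set S)
    (hA : ∀ n, ∃ W : ℕ → Set S, (∀ i, IsClosed (W i)) ∧ A n = ⋃ i, W i) :
    ∃ W : ℕ → Set S, (∀ i, IsClosed (W i)) ∧ ⋃ n, A n = ⋃ i, W i := by
  choose W hW hAW using hA
  refine ⟨fun k => W k.unpair.1 k.unpair.2, fun k => hW _ _, ?_⟩
  simp_rw [hAW]
  exact (Set.iUnion_unpair W).symm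

/-- In a Noetherian space, a subset `B` is a countable union of closed sets as soon as, for
every irreducible closed `T`, either `T ⊆ B` or `B ∩ T` is covered by countably many closed proper
subsets of `T`. -/
theorem exists_isClosed_iUnion_nat_of_irreducible {S : Type*} [TopologicalSpace S]
    [TopologicalSpace.NoetherianSpace S] (B : Set S)
    (hB : ∀ T : Set S, IsClosed T → IsIrreducible T →
      T ⊆ B ∨ ∃ Z : ℕ → Set S, (∀ n, IsClosed (Z n) ∧ Z n ⊂ T) ∧ B ∩ T ⊆ ⋃ n, Z n) :
    ∃ W : ℕ → Set S, (∀ i, IsClosed (W i)) ∧ B = ⋃ i, W i := by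
  suffices H : ∀ T : TopologicalSpace.Closeds S,
      ∃ W : ℕ → Set S, (∀ i, IsClosed (W i)) ∧ B ∩ (T : Set S) = ⋃ i, W i by
    simpa using H ⊤
  intro T
  induction T using WellFoundedLT.induction with
  | ind T ih =>
  have step : ∀ Z : ℕ → Set S, (∀ n, IsClosed (Z n) ∧ Z n ⊂ T) → B ∩ T ⊆ ⋃ n, Z n →
      ∃ W : ℕ → Set S, (∀ i, IsClosed (W i)) ∧ B ∩ (T : Set S) = ⋃ i, W i := by
    intro Z hZ hcov
    have hBT : B ∩ (T : Set S) = ⋃ n, B ∩ Z n := by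
      rw [← Set.inter_iUnion]
      exact Set.Subset.antisymm (Set.subset_inter Set.inter_subset_left hcov)
        (Set.inter_subset_inter_right B (Set.iUnion_subset fun n => (hZ n).2.subset))
    rw [hBT]
    exact exists_isClosed_iUnion_nat_of_iUnion _ fun n => ih ⟨Z n, (hZ n).1⟩ (hZ n).2
  by_cases hT : IsIrreducible (T : Set S)
  · rcases hB T T.isClosed hT with h | ⟨Z, hZ, hcov⟩
    · exact ⟨fun _ => T, fun _ => T.isClosed, by rw [Set.inter_eq_right.2 h, Set.iUnion_const]⟩
    · exact step Z hZ hcov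
  · rcases (T : Set S).eq_empty_or_nonempty with he | hne
    · exact ⟨fun _ => ∅, fun _ => isClosed_empty, by simp [he]⟩
    · have hpre : ¬ IsPreirreducible (T : Set S) := fun h => hT ⟨hne, h⟩
      rw [isPreirreducible_iff_isClosed_union_isClosed] at hpre
      push Not at hpre
      obtain ⟨X, Y, hX, hY, hcov, hTX, hTY⟩ := hpre
      refine step (fun n => if n = 0 then T ∩ X else T ∩ Y) (fun n => ?_) ?_
      · split_ifs
        · exact ⟨T.isClosed.inter hX, Set.inter_ssubset_left_iff.2 hTX⟩
        · exact ⟨T.isClosed.inter hY, Set.inter_ssubset_left_iff.2 hTY⟩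
      · rintro x ⟨-, hx⟩
        rcases hcov hx with h | h
        · exact Set.mem_iUnion.2 ⟨0, by simpa using ⟨hx, h⟩⟩
        · exact Set.mem_iUnion.2 ⟨1, by simpa using ⟨hx, h⟩⟩

/-- Generalized lower semicontinuity of dynamical degrees (topological core of
Theorem 3.1): on a Noetherian space whose nonempty irreducible closed subsets are
not countable unions of properly contained closed subsets, if each `g n` (`n ≥ 1`)
is generically constant on every irreducible closed subset, can only drop there,
and `g n s ^ (1/n)` converges to `lam s`, then every sublevel set of `lam` is a
countable union of closed subsets. -/
theorem stmt_0 {S : Type*} [TopologicalSpace S] [TopologicalSpace.NoetherianSpace S]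
    (hcount : ∀ T : Set S, IsClosed T → IsIrreducible T →
      ¬ ∃ W : ℕ → Set S, (∀ i, IsClosed (W i) ∧ W i ⊂ T) ∧ T = ⋃ i, W i)
    (g : ℕ → S → ℝ) (hg1 : ∀ n, 1 ≤ n → ∀ s, 1 ≤ g n s)
    (hgen : ∀ T : Set S, IsClosed T → IsIrreducible T → ∀ n, 1 ≤ n →
      ∃ (Z : Set S) (c : ℝ), IsClosed Z ∧ Z ⊂ T ∧ 1 ≤ c ∧
        (∀ t ∈ T \ Z, g n t = c) ∧ (∀ t ∈ T, g n t ≤ c))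
    (lam : S → ℝ)
    (hlim : ∀ s, Tendsto (fun n : ℕ => (g n s) ^ ((1 : ℝ) / n)) atTop (𝓝 (lam s))) :
    ∀ a : ℝ, ∃ W : ℕ → Set S, (∀ i, IsClosed (W i)) ∧
      {s : S | lam s ≤ a} = ⋃ i, W i := by
  intro a
  refine exists_isClosed_iUnion_nat_of_irreducible _ fun T hTc hT => ?_
  have hgen' := fun n : ℕ => hgen T hTc hT (n + 1) n.succ_pos
  choose Z c hZc hZT hc hgc hgle using hgen'
  obtain ⟨t, htT, htZ⟩ : ∃ t ∈ T, t ∉ ⋃ n, Z n := by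
    by_contra! h
    exact hcount T hTc hT ⟨Z, fun n => ⟨hZc n, hZT n⟩,
      Set.Subset.antisymm h (Set.iUnion_subset fun n => (hZT n).subset)⟩
  have hmax : ∀ u ∈ T, u ∉ ⋃ n, Z n → ∀ s ∈ T, lam s ≤ lam u := by
    intro u hu huZ s hs
    refine le_of_tendsto_of_tendsto (hlim s) (hlim u) ?_
    filter_upwards [eventually_ge_atTop 1] with n hn
    obtain ⟨m, rfl⟩ := Nat.exists_eq_add_of_le' hn
    have hgu : g (m + 1) u = c m := hgc m u ⟨hu, fun h => huZ (Set.mem_iUnion.2 ⟨m, h⟩)⟩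
    exact Real.rpow_le_rpow (zero_le_one.trans (hg1 _ hn s)) (hgu ▸ hgle m s hs) (by positivity)
  by_cases hta : lam t ≤ a
  · exact Or.inl fun s hs => (hmax t htT htZ s hs).trans hta
  · refine Or.inr ⟨Z, fun n => ⟨hZc n, hZT n⟩, ?_⟩
    rintro s ⟨hsa, hsT⟩
    by_contra hsZ
    exact hta ((hmax s hsT hsZ t htT).trans hsa)
end

section
/- Let S be a Noetherian topological space and λ : S → ℝ a function. Assume that for every nonempty irreducible closed subset T ⊆ S there exist a real constant c_T and a sequence (W_{T,n})_{n∈ℕ} of closed subsets of S with W_{T,n} ⊊ T for all n, such that λ(t) = c_T for every t ∈ T \ ⋃_n W_{T,n} and λ(t) ≤ c_T for every t ∈ T. Then for every a ∈ ℝ the set {s ∈ S : λ(s) ≤ a} is a union of countably many closed subsets of S. -/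
/-- Noetherian induction for Fσ sets, expressed as complements of Gδ sets: `V` is Fσ if, for each
irreducible closed set `T`, the set `T ∩ V` is Fσ whenever `Z ∩ V` is Fσ for all closed `Z ⊂ T`. -/
theorem isGδ_compl_of_irreducible_step {S : Type*} [TopologicalSpace S]
    [TopologicalSpace.NoetherianSpace S] (V : Set S)
    (step : ∀ T : Set S, IsClosed T → IsIrreducible T →
      (∀ Z : Set S, IsClosed Z → Z ⊂ T → IsGδ (Z ∩ V)ᶜ) → IsGδ (T ∩ V)ᶜ) :
    IsGδ Vᶜ := by
  have key (T : TopologicalSpace.Closeds S) : IsGδ ((T : Set S) ∩ V)ᶜ := by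
    induction T using WellFoundedLT.induction with
    | ind T ih =>
      by_cases hT : IsIrreducible (T : Set S)
      · exact step T T.isClosed hT fun Z hZ hZT => ih ⟨Z, hZ⟩ hZT
      · obtain ⟨C, hC, hClosed, hIrred, hTC⟩ :=
          TopologicalSpace.NoetherianSpace.exists_finite_set_isClosed_irreducible T.isClosed
        rw [hTC, Set.sUnion_eq_biUnion, Set.iUnion₂_inter, Set.compl_iUnion₂]
        refine .biInter hC.countable fun Z hZ => ih ⟨Z, hClosed Z hZ⟩ ?_
        have hZT : Z ⊆ T := hTC ▸ Set.subset_sUnion_of_mem hZ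
        exact hZT.ssubset_of_ne fun h => hT (h ▸ hIrred Z hZ)
  simpa using key ⊤

/-- Noetherian-induction step in the proof of Theorem 3.1: if `lam` is constant
outside a countable union of properly contained closed subsets on every nonempty
irreducible closed subset, and can only drop there, then every sublevel set of
`lam` is a countable union of closed subsets. -/
theorem stmt_1 {S : Type*} [TopologicalSpace S] [TopologicalSpace.NoetherianSpace S]
    (lam : S → ℝ)
    (h : ∀ T : Set S, IsClosed T → IsIrreducible T →
      ∃ (c : ℝ) (W : ℕ → Set S), (∀ n, IsClosed (W n) ∧ W n ⊂ T) ∧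
        (∀ t ∈ T \ ⋃ n, W n, lam t = c) ∧ (∀ t ∈ T, lam t ≤ c)) :
    ∀ a : ℝ, ∃ W : ℕ → Set S, (∀ i, IsClosed (W i)) ∧
      {s : S | lam s ≤ a} = ⋃ i, W i := by
  intro a
  have hV : IsGδ {s : S | lam s ≤ a}ᶜ := by
    refine isGδ_compl_of_irreducible_step _ fun T hT hTirr ih => ?_
    obtain ⟨c, W, hW, hconst, hle⟩ := h T hT hTirr
    by_cases hc : c ≤ a
    · have hTV : T ⊆ {s | lam s ≤ a} := fun t ht => (hle t ht).trans hc
      rw [Set.inter_eq_left.2 hTV]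
      exact hT.isOpen_compl.isGδ
    · have hTV : T ∩ {s | lam s ≤ a} = ⋃ n, W n ∩ {s | lam s ≤ a} := by
        rw [← Set.iUnion_inter]
        refine Set.Subset.antisymm (fun t ht => ⟨?_, ht.2⟩)
          (Set.inter_subset_inter_left _ (Set.iUnion_subset fun n => (hW n).2.subset))
        by_contra htW
        exact hc (hconst t ⟨ht.1, htW⟩ ▸ ht.2)
      rw [hTV, Set.compl_iUnion]
      exact .iInter fun n => ih _ (hW n).1 (hW n).2
  obtain ⟨U, hU, hVU⟩ := isGδ_iff_eq_iInter_nat.1 hV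
  refine ⟨fun n => (U n)ᶜ, fun n => (hU n).isClosed_compl, ?_⟩
  rw [← Set.compl_iInter, ← hVU, compl_compl]
end

section
/- Let S be a Noetherian topological space and f : S → ℝ a function. Assume that for every nonempty irreducible closed subset T ⊆ S there exist a real constant c_T and a closed subset Z_T ⊆ S with Z_T ⊊ T such that f(t) = c_T for every t ∈ T \ Z_T and f(t) ≤ c_T for every t ∈ T. Then for every a ∈ ℝ the set {s ∈ S : f(s) ≤ a} is closed in S. -/
/-- Topological skeleton of Lemma 3.2: on a Noetherian space, a function which on
every nonempty irreducible closed subset is constant outside a properly contained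
closed subset and can only drop there is lower semi-continuous in the sense that
all sublevel sets are closed. -/
theorem stmt_2 {S : Type*} [TopologicalSpace S] [TopologicalSpace.NoetherianSpace S]
    (f : S → ℝ)
    (h : ∀ T : Set S, IsClosed T → IsIrreducible T →
      ∃ (c : ℝ) (Z : Set S), IsClosed Z ∧ Z ⊂ T ∧
        (∀ t ∈ T \ Z, f t = c) ∧ (∀ t ∈ T, f t ≤ c)) :
    ∀ a : ℝ, IsClosed {s : S | f s ≤ a} := by
  intro a
  suffices H : ∀ C : TopologicalSpace.Closeds S, IsClosed ({s : S | f s ≤ a} ∩ C) by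
    simpa using H ⊤
  intro C
  induction C using WellFoundedLT.induction with
  | ind C ih =>
    obtain ⟨F, hF, hFclosed, hFirr, hC⟩ :=
      TopologicalSpace.NoetherianSpace.exists_finite_set_isClosed_irreducible C.isClosed
    rw [hC, Set.sUnion_eq_biUnion, Set.inter_iUnion₂]
    refine hF.isClosed_biUnion fun T hT => ?_
    obtain ⟨c, Z, hZ, hZT, hconst, hle⟩ := h T (hFclosed T hT) (hFirr T hT)
    by_cases hca : c ≤ a
    · have hT' : T ⊆ {s : S | f s ≤ a} := fun t ht => (hle t ht).trans hca
      rw [Set.inter_eq_right.mpr hT']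
      exact hFclosed T hT
    · have hTC : T ⊆ C := hC ▸ Set.subset_sUnion_of_mem hT
      have hEq : {s : S | f s ≤ a} ∩ T = {s : S | f s ≤ a} ∩ Z := by
        refine Set.Subset.antisymm (fun t ht => ⟨ht.1, ?_⟩)
          (Set.inter_subset_inter_right _ hZT.subset)
        by_contra htZ
        exact hca (hconst t ⟨ht.2, htZ⟩ ▸ ht.1)
      rw [hEq]
      exact ih ⟨Z, hZ⟩ (SetLike.coe_ssubset_coe.mp (hZT.trans_subset hTC))
end
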